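/- arXiv:1905.10936 — 9 statements merged into one kernel-verified Lean document; each statement's English description precedes it below -/
import Mathlib

section
/- Let d, M be positive integers, let 𝒞 : ℝ^d → ℝ^d be any map, let η_t > 0 for t ≥ 0 (with the convention η_{−1} = 0), and let g_{t,i} ∈ ℝ^d (1 ≤ i ≤ M, t ≥ 0) be arbitrary vectors. Define the dist-EF-SGD iterates from x_0 ∈ ℝ^d, e_{0,i} = 0, ẽ_0 = 0 by: p_{t,i} = g_{t,i} + (η_{t−1}/η_t) e_{t,i}; Δ_{t,i} = 𝒞(p_{t,i}); e_{t+1,i} = p_{t,i} − Δ_{t,i}; p̃_t = (1/M) Σ_{i=1}^M Δ_{t,i} + (η_{t−1}/η_t) ẽ_t; Δ̃_t = 𝒞(p̃_t); ẽ_{t+1} = p̃_t − Δ̃_t; x_{t+1} = x_t − η_t Δ̃_t. Then the error-corrected iterate x̃_t := x_t − η_{t−1} (ẽ_t + (1/M) Σ_{i=1}^M e_{t,i}) satisfies, for every t ≥ 0, x̃_{t+1} = x̃_t − η_t (1/M) Σ_{i=1}^M g_{t,i}. -/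
open Finset

/-- **Lemma (dist-EF-SGD error-corrected iterate recurrence).**
The error-corrected iterate `x̃ₜ = xₜ − η_{t−1}(ẽₜ + (1/M)∑ᵢ e_{t,i})` of dist-EF-SGD
satisfies `x̃_{t+1} = x̃ₜ − ηₜ (1/M) ∑ᵢ g_{t,i}`.  Here the convention `η_{−1} = 0` is
encoded by `(if t = 0 then 0 else η (t-1))`. -/
theorem dist_EF_SGD_error_corrected_recurrence
    (d M : ℕ) (hd : 0 < d) (hM : 0 < M)
    (C : EuclideanSpace ℝ (Fin d) → EuclideanSpace ℝ (Fin d))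
    (η : ℕ → ℝ) (hη : ∀ t, 0 < η t)
    (g p e : ℕ → Fin M → EuclideanSpace ℝ (Fin d))
    (pt et x : ℕ → EuclideanSpace ℝ (Fin d))
    (he0 : ∀ i, e 0 i = 0)
    (het0 : et 0 = 0)
    (hp : ∀ t i, p t i = g t i + ((if t = 0 then (0:ℝ) else η (t-1)) / η t) • e t i)
    (he : ∀ t i, e (t+1) i = p t i - C (p t i))
    (hpt : ∀ t, pt t = (M:ℝ)⁻¹ • ∑ i, C (p t i)
        + ((if t = 0 then (0:ℝ) else η (t-1)) / η t) • et t)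
    (het : ∀ t, et (t+1) = pt t - C (pt t))
    (hx : ∀ t, x (t+1) = x t - η t • C (pt t)) :
    ∀ t, x (t+1) - η t • (et (t+1) + (M:ℝ)⁻¹ • ∑ i, e (t+1) i)
        = (x t - (if t = 0 then (0:ℝ) else η (t-1)) • (et t + (M:ℝ)⁻¹ • ∑ i, e t i))
          - η t • ((M:ℝ)⁻¹ • ∑ i, g t i) := by
  intro t
  have hc : (if t = 0 then (0:ℝ) else η (t-1))
      = η t * ((if t = 0 then (0:ℝ) else η (t-1)) / η t) :=
    (mul_div_cancel₀ _ (hη t).ne').symm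
  have hsum : ∑ i, p t i = ∑ i, g t i
      + ((if t = 0 then (0:ℝ) else η (t-1)) / η t) • ∑ i, e t i := by
    simp only [hp, Finset.sum_add_distrib, Finset.smul_sum]
  have hpt' := hpt t
  simp only [hx, het, he, Finset.sum_sub_distrib]
  rw [hsum]
  generalize (if t = 0 then (0:ℝ) else η (t-1)) / η t = r at hc hpt' ⊢
  rw [hc]
  generalize C (pt t) = Δ
  rw [hpt']
  module
end

section
/- Let d, M be positive integers, let µ ∈ [0,1), let 𝒞 : ℝ^d → ℝ^d be any map, let η_t > 0 for t ≥ 0 (with the convention η_{−1} = 0), and let g_{t,i} ∈ ℝ^d be arbitrary vectors. Define the dist-EF-SGDM iterates from x_0 ∈ ℝ^d, m_{−1,i} = 0, e_{0,i} = 0, ẽ_0 = 0 by: m_{t,i} = µ m_{t−1,i} + g_{t,i}; p_{t,i} = µ m_{t,i} + g_{t,i} + (η_{t−1}/η_t) e_{t,i}; Δ_{t,i} = 𝒞(p_{t,i}); e_{t+1,i} = p_{t,i} − Δ_{t,i}; p̃_t = (1/M) Σ_{i=1}^M Δ_{t,i} + (η_{t−1}/η_t) ẽ_t; Δ̃_t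 = 𝒞(p̃_t); ẽ_{t+1} = p̃_t − Δ̃_t; x_{t+1} = x_t − η_t Δ̃_t. Then the error-corrected iterate x̃_t := x_t − η_{t−1} (ẽ_t + (1/M) Σ_{i=1}^M e_{t,i}) satisfies, for every t ≥ 0, x̃_{t+1} = x̃_t − η_t (1/M) Σ_{i=1}^M (µ m_{t,i} + g_{t,i}). -/
open Finset

/-- **Lemma (dist-EF-SGDM error-corrected iterate recurrence).**
For dist-EF-SGDM with Nesterov momentum parameter `μ ∈ [0,1)`, the error-corrected
iterate `x̃ₜ = xₜ − η_{t−1}(ẽₜ + (1/M)∑ᵢ e_{t,i})` satisfies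
`x̃_{t+1} = x̃ₜ − ηₜ (1/M) ∑ᵢ (μ m_{t,i} + g_{t,i})`.  The conventions `η_{−1} = 0` and
`m_{−1,i} = 0` are encoded via `if t = 0 then 0 else …`. -/
theorem dist_EF_SGDM_error_corrected_recurrence
    (d M : ℕ) (hd : 0 < d) (hM : 0 < M)
    (μ : ℝ) (hμ0 : 0 ≤ μ) (hμ1 : μ < 1)
    (C : EuclideanSpace ℝ (Fin d) → EuclideanSpace ℝ (Fin d))
    (η : ℕ → ℝ) (hη : ∀ t, 0 < η t)
    (g m p e : ℕ → Fin M → EuclideanSpace ℝ (Fin d))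
    (pt et x : ℕ → EuclideanSpace ℝ (Fin d))
    (he0 : ∀ i, e 0 i = 0)
    (het0 : et 0 = 0)
    (hm : ∀ t i, m t i = μ • (if t = 0 then 0 else m (t-1) i) + g t i)
    (hp : ∀ t i, p t i = μ • m t i + g t i
        + ((if t = 0 then (0:ℝ) else η (t-1)) / η t) • e t i)
    (he : ∀ t i, e (t+1) i = p t i - C (p t i))
    (hpt : ∀ t, pt t = (M:ℝ)⁻¹ • ∑ i, C (p t i)
        + ((if t = 0 then (0:ℝ) else η (t-1)) / η t) • et t)
    (het : ∀ t, et (t+1) = pt t - C (pt t))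
    (hx : ∀ t, x (t+1) = x t - η t • C (pt t)) :
    ∀ t, x (t+1) - η t • (et (t+1) + (M:ℝ)⁻¹ • ∑ i, e (t+1) i)
        = (x t - (if t = 0 then (0:ℝ) else η (t-1)) • (et t + (M:ℝ)⁻¹ • ∑ i, e t i))
          - η t • ((M:ℝ)⁻¹ • ∑ i, (μ • m t i + g t i)) := by
  intro t
  have hne : η t ≠ 0 := (hη t).ne'
  have hsum : ∑ i, e (t+1) i = ∑ i, (μ • m t i + g t i)
      + ((if t = 0 then (0:ℝ) else η (t-1)) / η t) • ∑ i, e t i - ∑ i, C (p t i) := by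
    rw [smul_sum, ← sum_add_distrib, ← sum_sub_distrib]
    exact sum_congr rfl fun i _ => by rw [he, ← hp]
  rw [hsum, hx, het, hpt]
  generalize (if t = 0 then (0:ℝ) else η (t-1)) = a
  obtain ⟨r, rfl⟩ : ∃ r, a = η t * r := ⟨a / η t, by field_simp⟩
  rw [mul_div_cancel_left₀ _ hne]
  module
end

section
/- Let {𝒢_1, …, 𝒢_B} be a partition of {1, …, d} with |𝒢_b| = d_b ≥ 1, and define the blockwise compressor 𝒞_B : ℝ^d → ℝ^d by setting, on each block b, (𝒞_B(v))_{𝒢_b} = (‖v_{𝒢_b}‖_1 / d_b) · sign(v_{𝒢_b}), where v_{𝒢_b} is the subvector of v with coordinates in 𝒢_b and sign acts coordinatewise (with sign(0) = 0). Then for every v ∈ ℝ^d, ‖𝒞_B(v) − v‖_2² ≤ (1 − φ(v)) ‖v‖_2², where φ(v) = min over blocks b with v_{𝒢_b} ≠ 0 of ‖v_{𝒢_b}‖_1² / (d_b ‖v_{𝒢_b}‖_2²) (with φ(v) = 1 if all blocks are zero); moreover φ(v) ≥ min_{b ∈ {1,…,B}} 1/d_b. In particular, 𝒞_B is a (min_b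 1/d_b)-approximate compressor. -/
open Finset
open scoped Classical

/-- The block of coordinates assigned to block index `b` by the assignment `blk`. -/
noncomputable def block {d B : ℕ} (blk : Fin d → Fin B) (b : Fin B) : Finset (Fin d) :=
  Finset.univ.filter (fun j => blk j = b)

/-- The blockwise scaled-sign compressor `𝒞_B`: on each block `𝒢_b`,
`(𝒞_B(v))_{𝒢_b} = (‖v_{𝒢_b}‖₁ / d_b) · sign(v_{𝒢_b})`. -/
noncomputable def blockCompress {d B : ℕ} (blk : Fin d → Fin B) (v : Fin d → ℝ) :
    Fin d → ℝ :=
  fun j => ((∑ k ∈ block blk (blk j), |v k|) / (block blk (blk j)).card) * Real.sign (v j)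

/-- The blockwise approximation factor
`φ(v) = min_{b : v_{𝒢_b} ≠ 0} ‖v_{𝒢_b}‖₁² / (d_b ‖v_{𝒢_b}‖₂²)`, with `φ(v) = 1` when all
blocks are zero. -/
noncomputable def blockPhi {d B : ℕ} (blk : Fin d → Fin B) (v : Fin d → ℝ) : ℝ :=
  if h : (Finset.univ.filter (fun b : Fin B => ∃ j ∈ block blk b, v j ≠ 0)).Nonempty then
    (Finset.univ.filter (fun b : Fin B => ∃ j ∈ block blk b, v j ≠ 0)).inf' h
      (fun b => (∑ k ∈ block blk b, |v k|)^2 /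
        (((block blk b).card : ℝ) * ∑ k ∈ block blk b, (v k)^2))
  else 1

lemma sq_mul_sign_sub_le (c x : ℝ) :
    (c * Real.sign x - x) ^ 2 ≤ c ^ 2 - 2 * c * |x| + x ^ 2 := by
  rcases lt_trichotomy x 0 with hx | rfl | hx
  · rw [Real.sign_of_neg hx, abs_of_neg hx]
    linarith
  · simp [sq_nonneg]
  · rw [Real.sign_of_pos hx, abs_of_pos hx]
    linarith

/-- The error of the scaled-sign compressor on a single index set. -/
lemma sum_sq_scaled_sign_sub_le {ι : Type*} (s : Finset ι) (v : ι → ℝ) :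
    ∑ j ∈ s, ((∑ k ∈ s, |v k|) / s.card * Real.sign (v j) - v j) ^ 2 ≤
      ∑ j ∈ s, v j ^ 2 - (∑ k ∈ s, |v k|) ^ 2 / s.card := by
  rcases s.eq_empty_or_nonempty with rfl | hs
  · simp
  have hcard : (s.card : ℝ) ≠ 0 := by exact_mod_cast hs.card_pos.ne'
  refine (Finset.sum_le_sum fun j _ => sq_mul_sign_sub_le _ (v j)).trans_eq ?_
  rw [Finset.sum_add_distrib, Finset.sum_sub_distrib, ← Finset.mul_sum, Finset.sum_const,
    nsmul_eq_mul]
  field_simp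
  ring

lemma sum_sum_block {d B : ℕ} (blk : Fin d → Fin B) (f : Fin d → ℝ) :
    ∑ b, ∑ j ∈ block blk b, f j = ∑ j, f j :=
  Finset.sum_fiberwise _ blk f

lemma sum_block_sq_pos {d B : ℕ} {blk : Fin d → Fin B} {v : Fin d → ℝ} {b : Fin B}
    (hb : ∃ j ∈ block blk b, v j ≠ 0) : 0 < ∑ k ∈ block blk b, v k ^ 2 := by
  obtain ⟨j, hj, hvj⟩ := hb
  exact Finset.sum_pos' (fun k _ => sq_nonneg (v k)) ⟨j, hj, by positivity⟩

lemma blockPhi_mul_sum_sq_le {d B : ℕ} (blk : Fin d → Fin B) (v : Fin d → ℝ) (b : Fin B) :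
    blockPhi blk v * ∑ k ∈ block blk b, v k ^ 2 ≤
      (∑ k ∈ block blk b, |v k|) ^ 2 / (block blk b).card := by
  by_cases hb : ∃ j ∈ block blk b, v j ≠ 0
  · have hmem : b ∈ Finset.univ.filter (fun b : Fin B => ∃ j ∈ block blk b, v j ≠ 0) := by
      simpa using hb
    have hphi : blockPhi blk v ≤ (∑ k ∈ block blk b, |v k|) ^ 2 /
        (((block blk b).card : ℝ) * ∑ k ∈ block blk b, v k ^ 2) := by
      rw [blockPhi, dif_pos ⟨b, hmem⟩]
      exact Finset.inf'_le _ hmem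
    rwa [← div_div, le_div_iff₀ (sum_block_sq_pos hb)] at hphi
  · push Not at hb
    rw [Finset.sum_eq_zero fun k hk => by rw [hb k hk]; simp, mul_zero]
    positivity

lemma sum_sq_blockCompress_sub_le {d B : ℕ} (blk : Fin d → Fin B) (v : Fin d → ℝ) :
    ∑ j, (blockCompress blk v j - v j) ^ 2 ≤ (1 - blockPhi blk v) * ∑ j, v j ^ 2 := by
  rw [← sum_sum_block blk, ← sum_sum_block blk (fun j => v j ^ 2), Finset.mul_sum]
  refine Finset.sum_le_sum fun b _ => ?_
  have hcongr : ∑ j ∈ block blk b, (blockCompress blk v j - v j) ^ 2 =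
      ∑ j ∈ block blk b,
        ((∑ k ∈ block blk b, |v k|) / (block blk b).card * Real.sign (v j) - v j) ^ 2 := by
    refine Finset.sum_congr rfl fun j hj => ?_
    have hjb : blk j = b := (Finset.mem_filter.mp hj).2
    rw [blockCompress, hjb]
  rw [hcongr]
  linarith [sum_sq_scaled_sign_sub_le (block blk b) v, blockPhi_mul_sum_sq_le blk v b]

lemma inf'_one_div_card_le_blockPhi {d B : ℕ} (blk : Fin d → Fin B)
    (h : (Finset.univ : Finset (Fin B)).Nonempty) (v : Fin d → ℝ) :
    Finset.univ.inf' h (fun b : Fin B => 1 / ((block blk b).card : ℝ)) ≤ blockPhi blk v := by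
  rw [blockPhi]
  split_ifs with hne
  · refine Finset.le_inf' _ _ fun b hb => (Finset.inf'_le _ (Finset.mem_univ b)).trans ?_
    have hpos := sum_block_sq_pos (Finset.mem_filter.mp hb).2
    have hsq : ∑ k ∈ block blk b, v k ^ 2 ≤ (∑ k ∈ block blk b, |v k|) ^ 2 := by
      simpa using Finset.sum_sq_le_sq_sum_of_nonneg (s := block blk b) (f := fun k => |v k|)
        (fun k _ => abs_nonneg (v k))
    rw [mul_comm, ← div_div]
    gcongr
    rwa [one_le_div hpos]
  · obtain ⟨b, hb⟩ := h
    refine (Finset.inf'_le _ hb).trans ?_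
    rw [one_div]
    exact Nat.cast_inv_le_one _

/-- **The blockwise scaled-sign compressor is an approximate compressor.**
For every `v`, `‖𝒞_B(v) − v‖₂² ≤ (1 − φ(v))‖v‖₂²`; moreover
`φ(v) ≥ min_b 1/d_b`, so `𝒞_B` is a `(min_b 1/d_b)`-approximate compressor. -/
theorem blockCompress_approx_compressor
    (d B : ℕ) (hd : 0 < d) (hB : 0 < B)
    (blk : Fin d → Fin B) (hpart : ∀ b, ∃ j, blk j = b) :
    (∀ v : Fin d → ℝ,
        ∑ j, (blockCompress blk v j - v j)^2 ≤ (1 - blockPhi blk v) * ∑ j, (v j)^2)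
    ∧ (∀ v : Fin d → ℝ,
        (Finset.univ.inf' ⟨⟨0, hB⟩, Finset.mem_univ _⟩
            (fun b : Fin B => 1 / ((block blk b).card : ℝ))) ≤ blockPhi blk v)
    ∧ (∀ v : Fin d → ℝ,
        ∑ j, (blockCompress blk v j - v j)^2
          ≤ (1 - Finset.univ.inf' ⟨⟨0, hB⟩, Finset.mem_univ _⟩
              (fun b : Fin B => 1 / ((block blk b).card : ℝ))) * ∑ j, (v j)^2) := by
  have hmin := inf'_one_div_card_le_blockPhi blk ⟨⟨0, hB⟩, Finset.mem_univ _⟩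
  refine ⟨sum_sq_blockCompress_sub_le blk, hmin, fun v => ?_⟩
  refine (sum_sq_blockCompress_sub_le blk v).trans ?_
  gcongr
  exact hmin v
end

section
/- Let B ≥ 1 and d̃ ≥ 1, let d = B·d̃, and partition {1,…,d} into B consecutive blocks 𝒢_1, …, 𝒢_B of size d̃ each. Fix c > 0 and α ∈ (0,1), and let v ∈ ℝ^d be any vector with |v_j| = c·α^{b−1} for every j ∈ 𝒢_b and every b. Then (i) ‖v‖_1²/(d‖v‖_2²) = (1+α)(1−α^B) / (B(1−α)(1+α^B)); and (ii) for every block b, ‖v_{𝒢_b}‖_1²/(d̃ ‖v_{𝒢_b}‖_2²) = 1, so the blockwise approximation factor φ(v) = min_b ‖v_{𝒢_b}‖_1²/(d̃‖v_{𝒢_b}‖_2²) equals 1. -/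
open Finset

/-- Summing a function of the block index over `B` consecutive blocks of size `n`. -/
lemma sum_fin_mul_div {M : Type*} [AddCommMonoid M] (B n : ℕ) (f : ℕ → M) :
    ∑ j : Fin (B * n), f ((j : ℕ) / n) = n • ∑ b ∈ range B, f b := by
  rw [← finProdFinEquiv.sum_comp, Fintype.sum_prod_type, smul_sum,
    ← Fin.sum_univ_eq_sum_range (fun b => n • f b)]
  refine sum_congr rfl fun b _ => ?_
  have h (i : Fin n) : ((finProdFinEquiv (b, i) : Fin (B * n)) : ℕ) / n = b := by
    simp [Nat.add_mul_div_left _ _ i.pos, Nat.div_eq_of_lt i.isLt]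
  simp only [h, sum_const, card_univ, Fintype.card_fin]

/-- Summing a function of the block index over a single block of size `n`. -/
lemma sum_filter_div_eq {M : Type*} [AddCommMonoid M] {B : ℕ} (n : ℕ) (f : ℕ → M) (b : Fin B) :
    ∑ j ∈ univ.filter (fun j : Fin (B * n) => (j : ℕ) / n = b), f ((j : ℕ) / n) = n • f b := by
  rw [sum_filter, sum_fin_mul_div B n fun k => if k = b then f k else 0]
  simp [sum_ite_eq']

/-- **Blockwise vs. non-blockwise compression factors on a geometric-magnitude vector.**
Partition `{0,…,B·d̃−1}` into `B` consecutive blocks of size `d̃` (block of `j` is `j / d̃`),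
and let `|v_j| = c·α^b` on block `b` with `c > 0`, `α ∈ (0,1)`.  Then
(i) `‖v‖₁²/(d‖v‖₂²) = (1+α)(1−α^B)/(B(1−α)(1+α^B))`;
(ii) every block has factor `‖v_{𝒢_b}‖₁²/(d̃‖v_{𝒢_b}‖₂²) = 1`, hence `φ(v) = 1`. -/
theorem geometric_blocks_compression_factor
    (B dt : ℕ) (hB : 1 ≤ B) (hdt : 1 ≤ dt)
    (d : ℕ) (hd : d = B * dt)
    (c α : ℝ) (hc : 0 < c) (hα0 : 0 < α) (hα1 : α < 1)
    (v : Fin d → ℝ)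
    (hv : ∀ j : Fin d, |v j| = c * α ^ ((j : ℕ) / dt)) :
    ((∑ j, |v j|)^2 / ((d : ℝ) * ∑ j, (v j)^2)
        = (1 + α) * (1 - α ^ B) / ((B : ℝ) * (1 - α) * (1 + α ^ B)))
    ∧ (∀ b : Fin B,
        (∑ j ∈ Finset.univ.filter (fun j : Fin d => (j : ℕ) / dt = (b : ℕ)), |v j|)^2
            / ((dt : ℝ) * ∑ j ∈ Finset.univ.filter (fun j : Fin d => (j : ℕ) / dt = (b : ℕ)),
                (v j)^2)
          = 1)
    ∧ (Finset.univ.inf' ⟨⟨0, hB⟩, Finset.mem_univ _⟩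
        (fun b : Fin B =>
          (∑ j ∈ Finset.univ.filter (fun j : Fin d => (j : ℕ) / dt = (b : ℕ)), |v j|)^2
            / ((dt : ℝ) * ∑ j ∈ Finset.univ.filter (fun j : Fin d => (j : ℕ) / dt = (b : ℕ)),
                (v j)^2)) = 1) := by
  subst hd
  have hsq (j) : v j ^ 2 = c ^ 2 * (α ^ 2) ^ ((j : ℕ) / dt) := by
    rw [← sq_abs, hv]; ring
  have hdt0 : (0 : ℝ) < dt := by exact_mod_cast hdt
  have hB0 : (0 : ℝ) < B := by exact_mod_cast hB
  have hblock (b : Fin B) :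
      (∑ j ∈ univ.filter (fun j : Fin (B * dt) => (j : ℕ) / dt = (b : ℕ)), |v j|) ^ 2
        / ((dt : ℝ) * ∑ j ∈ univ.filter (fun j : Fin (B * dt) => (j : ℕ) / dt = (b : ℕ)),
            (v j) ^ 2) = 1 := by
    simp only [hv, hsq]
    rw [sum_filter_div_eq dt (fun k => c * α ^ k) b,
      sum_filter_div_eq dt (fun k => c ^ 2 * (α ^ 2) ^ k) b, nsmul_eq_mul, nsmul_eq_mul,
      div_eq_one_iff_eq (by positivity)]
    ring
  refine ⟨?_, hblock, ?_⟩
  · simp only [hv, hsq]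
    rw [sum_fin_mul_div B dt (fun k => c * α ^ k),
      sum_fin_mul_div B dt (fun k => c ^ 2 * (α ^ 2) ^ k), ← mul_sum, ← mul_sum,
      geom_sum_eq hα1.ne, geom_sum_eq (by nlinarith), nsmul_eq_mul, nsmul_eq_mul, ← pow_mul,
      mul_comm 2 B, pow_mul]
    have hαB : α ^ B < 1 := pow_lt_one₀ hα0.le hα1 (by lia)
    have hαB0 : 0 < α ^ B := pow_pos hα0 B
    generalize α ^ B = x at *
    have h1 : α - 1 ≠ 0 := by linarith
    have h2 : 1 - α ≠ 0 := by linarith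
    have h3 : α ^ 2 - 1 ≠ 0 := by nlinarith
    have h4 : x ^ 2 - 1 ≠ 0 := by nlinarith
    have h5 : 1 + x ≠ 0 := by linarith
    push_cast
    field_simp
    ring
  · simp only [hblock]
    exact inf'_const _ _
end

section
/- Consider dist-EF-SGDM with momentum parameter µ ∈ [0,1), constant stepsize η_t = η > 0, a δ-approximate compressor 𝒞 (δ ∈ (0,1]), and stochastic gradients g_{t,i} satisfying E[‖g_{t,i}‖_2²] ≤ G² for all t, i. Then for every t ≥ 0, the average of the workers' accumulated-error second moments satisfies (1/M) Σ_{i=1}^M E[‖e_{t,i}‖_2²] ≤ 4(1−δ)G² / (δ²(1−µ)²). -/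
open Finset MeasureTheory

/-- For a nonnegative radius, the `L²` seminorm ball is described by the second moment. -/
lemma eLpNorm_two_le_ofReal_iff {Ω E : Type*} [MeasurableSpace Ω] {μ : Measure Ω}
    [NormedAddCommGroup E] {f : Ω → E} (hf : MemLp f 2 μ) {K : ℝ} (hK : 0 ≤ K) :
    eLpNorm f 2 μ ≤ ENNReal.ofReal K ↔ ∫ ω, ‖f ω‖ ^ 2 ∂μ ≤ K ^ 2 := by
  have hI : 0 ≤ ∫ ω, ‖f ω‖ ^ 2 ∂μ := integral_nonneg fun _ => by positivity
  rw [hf.eLpNorm_eq_integral_rpow_norm (by norm_num) (by norm_num),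
    ENNReal.ofReal_le_ofReal_iff hK]
  simp only [ENNReal.toReal_ofNat, Real.rpow_ofNat]
  rw [← one_div, ← Real.sqrt_eq_rpow, Real.sqrt_le_left hK]

/-- A heavy-ball step keeps the `L²` ball of radius `G / (1 - mo)` invariant. -/
lemma eLpNorm_smul_add_le {Ω E : Type*} [MeasurableSpace Ω] {μ : Measure Ω}
    [NormedAddCommGroup E] [NormedSpace ℝ E] {f g : Ω → E} {mo G : ℝ}
    (hmo0 : 0 ≤ mo) (hmo1 : mo < 1) (hG : 0 ≤ G)
    (hf : AEStronglyMeasurable f μ) (hg : AEStronglyMeasurable g μ)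
    (hfK : eLpNorm f 2 μ ≤ ENNReal.ofReal (G / (1 - mo)))
    (hgG : eLpNorm g 2 μ ≤ ENNReal.ofReal G) :
    eLpNorm (mo • f + g) 2 μ ≤ ENNReal.ofReal (G / (1 - mo)) := by
  have h1 : 0 < 1 - mo := by linarith
  have hK : G / (1 - mo) = mo * (G / (1 - mo)) + G := by field_simp; ring
  calc eLpNorm (mo • f + g) 2 μ
      ≤ eLpNorm (mo • f) 2 μ + eLpNorm g 2 μ :=
        eLpNorm_add_le (hf.const_smul mo) hg (by norm_num)
    _ ≤ ENNReal.ofReal mo * ENNReal.ofReal (G / (1 - mo)) + ENNReal.ofReal G := by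
        rw [eLpNorm_const_smul, Real.enorm_of_nonneg hmo0]
        gcongr
    _ = ENNReal.ofReal (G / (1 - mo)) := by
        rw [← ENNReal.ofReal_mul hmo0, ← ENNReal.ofReal_add (by positivity) hG, ← hK]

/-- The compression residual after adding an `L²`-bounded input keeps the ball of radius
`2 s K / δ`, `s = √(1 - δ)`, invariant. -/
lemma eLpNorm_compression_residual_le {Ω E : Type*} [MeasurableSpace Ω] {μ : Measure Ω}
    [NormedAddCommGroup E] {C : E → E} {q e : Ω → E} {δ K : ℝ}
    (hδ0 : 0 < δ) (hδ1 : δ ≤ 1) (hK : 0 ≤ K)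
    (hC : ∀ v, ‖C v - v‖ ^ 2 ≤ (1 - δ) * ‖v‖ ^ 2)
    (hq : AEStronglyMeasurable q μ) (he : AEStronglyMeasurable e μ)
    (hqK : eLpNorm q 2 μ ≤ ENNReal.ofReal K)
    (heK : eLpNorm e 2 μ ≤ ENNReal.ofReal (2 * √(1 - δ) * K / δ)) :
    eLpNorm (fun ω => (q + e) ω - C ((q + e) ω)) 2 μ
      ≤ ENNReal.ofReal (2 * √(1 - δ) * K / δ) := by
  have hs0 : 0 ≤ √(1 - δ) := Real.sqrt_nonneg _
  have hs2 : √(1 - δ) ^ 2 = 1 - δ := Real.sq_sqrt (by linarith)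
  have hs : 2 * √(1 - δ) ≤ 2 - δ := by nlinarith [sq_nonneg (√(1 - δ) - 1)]
  have hres (v : E) : ‖v - C v‖ ≤ √(1 - δ) * ‖v‖ := by
    rw [norm_sub_rev]
    refine le_of_sq_le_sq ?_ (by positivity)
    rw [mul_pow, hs2]
    exact hC v
  calc eLpNorm (fun ω => (q + e) ω - C ((q + e) ω)) 2 μ
      ≤ ENNReal.ofReal √(1 - δ) * eLpNorm (q + e) 2 μ :=
        eLpNorm_le_mul_eLpNorm_of_ae_le_mul (.of_forall fun ω => hres _) 2
    _ ≤ ENNReal.ofReal √(1 - δ) *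
          (ENNReal.ofReal K + ENNReal.ofReal (2 * √(1 - δ) * K / δ)) := by
        gcongr
        exact (eLpNorm_add_le hq he (by norm_num)).trans (add_le_add hqK heK)
    _ = ENNReal.ofReal (√(1 - δ) * (K + 2 * √(1 - δ) * K / δ)) := by
        rw [← ENNReal.ofReal_add hK (by positivity), ← ENNReal.ofReal_mul hs0]
    _ ≤ ENNReal.ofReal (2 * √(1 - δ) * K / δ) := by
        refine ENNReal.ofReal_le_ofReal ?_
        have : K + 2 * √(1 - δ) * K / δ ≤ 2 * K / δ := by
          rw [le_div_iff₀ hδ0, add_mul, div_mul_cancel₀ _ hδ0.ne']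
          nlinarith
        calc √(1 - δ) * (K + 2 * √(1 - δ) * K / δ) ≤ √(1 - δ) * (2 * K / δ) := by gcongr
          _ = 2 * √(1 - δ) * K / δ := by ring

/-- **Worker accumulated-error bound for dist-EF-SGDM** (constant stepsize).
With a `δ`-approximate compressor, momentum `μ ∈ [0,1)` and stochastic gradients with
`E[‖g_{t,i}‖²] ≤ G²`, for every `t`,
`(1/M) ∑ᵢ E[‖e_{t,i}‖²] ≤ 4(1−δ)G²/(δ²(1−μ)²)`. -/
theorem dist_EF_SGDM_worker_error_bound
    (d M : ℕ) (hd : 0 < d) (hM : 0 < M)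
    {Ω : Type*} [MeasurableSpace Ω] (μ : Measure Ω) [IsProbabilityMeasure μ]
    (mo δ G η : ℝ) (hmo0 : 0 ≤ mo) (hmo1 : mo < 1)
    (hδ0 : 0 < δ) (hδ1 : δ ≤ 1) (hG : 0 ≤ G) (hη : 0 < η)
    (C : EuclideanSpace ℝ (Fin d) → EuclideanSpace ℝ (Fin d))
    (hC : ∀ v, ‖C v - v‖^2 ≤ (1 - δ) * ‖v‖^2)
    (hCmeas : Measurable C)
    (g m p e : ℕ → Fin M → Ω → EuclideanSpace ℝ (Fin d))
    (pt et x : ℕ → Ω → EuclideanSpace ℝ (Fin d))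
    (hgmeas : ∀ t i, Measurable (g t i))
    (hgint : ∀ t i, Integrable (fun ω => ‖g t i ω‖^2) μ)
    (hgG : ∀ t i, ∫ ω, ‖g t i ω‖^2 ∂μ ≤ G^2)
    (he0 : ∀ i ω, e 0 i ω = 0)
    (het0 : ∀ ω, et 0 ω = 0)
    (hm : ∀ t i ω, m t i ω = mo • (if t = 0 then 0 else m (t-1) i ω) + g t i ω)
    (hp : ∀ t i ω, p t i ω = mo • m t i ω + g t i ω + e t i ω)
    (he : ∀ t i ω, e (t+1) i ω = p t i ω - C (p t i ω))
    (hpt : ∀ t ω, pt t ω = (M:ℝ)⁻¹ • ∑ i, C (p t i ω) + et t ω)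
    (het : ∀ t ω, et (t+1) ω = pt t ω - C (pt t ω))
    (hx : ∀ t ω, x (t+1) ω = x t ω - η • C (pt t ω)) :
    ∀ t, (M:ℝ)⁻¹ * ∑ i, ∫ ω, ‖e t i ω‖^2 ∂μ
      ≤ 4 * (1 - δ) * G^2 / (δ^2 * (1 - mo)^2) := by
  have h1 : 0 < 1 - mo := by linarith
  set K : ℝ := G / (1 - mo) with hKdef
  have hK : 0 ≤ K := by positivity
  have hgM (t i) : eLpNorm (g t i) 2 μ ≤ ENNReal.ofReal G :=
    (eLpNorm_two_le_ofReal_iff ((memLp_two_iff_integrable_sq_norm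
      (hgmeas t i).aestronglyMeasurable).2 (hgint t i)) hG).2 (hgG t i)
  have hmB (t i) : Measurable (m t i) ∧ eLpNorm (m t i) 2 μ ≤ ENNReal.ofReal K := by
    induction t with
    | zero =>
      have h : m 0 i = mo • (0 : Ω → EuclideanSpace ℝ (Fin d)) + g 0 i := by
        ext1 ω
        simpa using hm 0 i ω
      rw [h]
      exact ⟨(measurable_zero.const_smul mo).add (hgmeas 0 i),
        eLpNorm_smul_add_le hmo0 hmo1 hG aestronglyMeasurable_zero
          (hgmeas 0 i).aestronglyMeasurable (by simp) (hgM 0 i)⟩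
    | succ t ih =>
      have h : m (t + 1) i = mo • m t i + g (t + 1) i := by
        ext1 ω
        simpa using hm (t + 1) i ω
      rw [h]
      exact ⟨(ih.1.const_smul mo).add (hgmeas _ i),
        eLpNorm_smul_add_le hmo0 hmo1 hG ih.1.aestronglyMeasurable
          (hgmeas _ i).aestronglyMeasurable ih.2 (hgM _ i)⟩
  have heB (t i) : Measurable (e t i) ∧
      eLpNorm (e t i) 2 μ ≤ ENNReal.ofReal (2 * √(1 - δ) * K / δ) := by
    induction t with
    | zero =>
      have h : e 0 i = 0 := funext (he0 i)
      rw [h]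
      exact ⟨measurable_zero, by simp⟩
    | succ t ih =>
      have hq : Measurable (mo • m t i + g t i) := ((hmB t i).1.const_smul mo).add (hgmeas t i)
      have h : e (t + 1) i = fun ω => ((mo • m t i + g t i) + e t i) ω
          - C (((mo • m t i + g t i) + e t i) ω) := by
        ext1 ω
        rw [he, hp]
        rfl
      rw [h]
      exact ⟨(hq.add ih.1).sub (hCmeas.comp (hq.add ih.1)),
        eLpNorm_compression_residual_le hδ0 hδ1 hK hC hq.aestronglyMeasurable
          ih.1.aestronglyMeasurable
          (eLpNorm_smul_add_le hmo0 hmo1 hG (hmB t i).1.aestronglyMeasurable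
            (hgmeas t i).aestronglyMeasurable (hmB t i).2 (hgM t i)) ih.2⟩
  intro t
  have hbound (i) : ∫ ω, ‖e t i ω‖ ^ 2 ∂μ ≤ 4 * (1 - δ) * G ^ 2 / (δ ^ 2 * (1 - mo) ^ 2) := by
    refine ((eLpNorm_two_le_ofReal_iff ⟨(heB t i).1.aestronglyMeasurable,
      (heB t i).2.trans_lt ENNReal.ofReal_lt_top⟩ (by positivity)).1 (heB t i).2).trans_eq ?_
    rw [div_pow, mul_pow, mul_pow, Real.sq_sqrt (by linarith), hKdef]
    field_simp
    ring
  have hM' : (0 : ℝ) < M := by exact_mod_cast hM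
  rw [inv_mul_le_iff₀ hM']
  simpa using Finset.sum_le_sum fun i (_ : i ∈ Finset.univ) => hbound i
end

section
/- Consider dist-EF-SGDM with momentum parameter µ ∈ [0,1), constant stepsize η_t = η > 0, a δ-approximate compressor 𝒞 (δ ∈ (0,1]), and stochastic gradients g_{t,i} satisfying E[‖g_{t,i}‖_2²] ≤ G² for all t, i. Then for every t ≥ 0, the server's accumulated error satisfies E[‖ẽ_t‖_2²] ≤ 64(1−δ)G² / (δ⁴(1−µ)²). -/
open Finset MeasureTheory

section

variable {Ω E : Type*} [MeasurableSpace Ω] {μ : Measure Ω} [NormedAddCommGroup E]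
  [MeasurableSpace E]

/-- `f` is measurable with `L²` norm at most `c ≥ 0`. -/
def L2BoundedBy (μ : Measure Ω) (f : Ω → E) (c : ℝ) : Prop :=
  Measurable f ∧ 0 ≤ c ∧ eLpNorm f 2 μ ≤ ENNReal.ofReal c

namespace L2BoundedBy

theorem zero {c : ℝ} (hc : 0 ≤ c) : L2BoundedBy μ (fun _ => (0 : E)) c :=
  ⟨measurable_const, hc, by simp⟩

theorem of_norm_le_mul {f g : Ω → E} {a k : ℝ} (hf : L2BoundedBy μ f a) (hg : Measurable g)
    (hk : 0 ≤ k) (h : ∀ ω, ‖g ω‖ ≤ k * ‖f ω‖) : L2BoundedBy μ g (k * a) := by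
  refine ⟨hg, mul_nonneg hk hf.2.1, ?_⟩
  rw [ENNReal.ofReal_mul hk]
  exact (eLpNorm_le_mul_eLpNorm_of_ae_le_mul (Filter.Eventually.of_forall h) 2).trans
    (by gcongr; exact hf.2.2)

variable [BorelSpace E]

theorem smul [NormedSpace ℝ E] {f : Ω → E} {a k : ℝ} (hf : L2BoundedBy μ f a) (hk : 0 ≤ k) :
    L2BoundedBy μ (fun ω => k • f ω) (k * a) :=
  hf.of_norm_le_mul (hf.1.const_smul k) hk fun ω => by
    rw [norm_smul, Real.norm_of_nonneg hk]

variable [SecondCountableTopology E]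

theorem of_integral_le {f : Ω → E} {c : ℝ} (hf : Measurable f)
    (hint : Integrable (fun ω => ‖f ω‖ ^ 2) μ) (hc : 0 ≤ c)
    (h : ∫ ω, ‖f ω‖ ^ 2 ∂μ ≤ c ^ 2) : L2BoundedBy μ f c := by
  have hLp : MemLp f 2 μ := (memLp_two_iff_integrable_sq_norm hf.aestronglyMeasurable).2 hint
  refine ⟨hf, hc, ?_⟩
  rw [hLp.eLpNorm_eq_integral_rpow_norm (by norm_num) (by norm_num)]
  apply ENNReal.ofReal_le_ofReal
  simp only [ENNReal.toReal_ofNat, Real.rpow_ofNat]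
  rw [← one_div, ← Real.sqrt_eq_rpow]
  exact Real.sqrt_le_iff.2 ⟨hc, h⟩

theorem integral_le {f : Ω → E} {c : ℝ} (h : L2BoundedBy μ f c) :
    ∫ ω, ‖f ω‖ ^ 2 ∂μ ≤ c ^ 2 := by
  obtain ⟨hf, hc, hb⟩ := h
  have hLp : MemLp f 2 μ := ⟨hf.aestronglyMeasurable, hb.trans_lt ENNReal.ofReal_lt_top⟩
  rw [hLp.eLpNorm_eq_integral_rpow_norm (by norm_num) (by norm_num),
    ENNReal.ofReal_le_ofReal_iff hc] at hb
  simp only [ENNReal.toReal_ofNat, Real.rpow_ofNat] at hb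
  rw [← one_div, ← Real.sqrt_eq_rpow] at hb
  exact (Real.sqrt_le_iff.1 hb).2

theorem add {f g : Ω → E} {a b : ℝ} (hf : L2BoundedBy μ f a) (hg : L2BoundedBy μ g b) :
    L2BoundedBy μ (fun ω => f ω + g ω) (a + b) := by
  refine ⟨hf.1.add hg.1, add_nonneg hf.2.1 hg.2.1, ?_⟩
  rw [ENNReal.ofReal_add hf.2.1 hg.2.1]
  exact (eLpNorm_add_le hf.1.aestronglyMeasurable hg.1.aestronglyMeasurable (by norm_num)).trans
    (add_le_add hf.2.2 hg.2.2)

theorem sum {ι : Type*} (s : Finset ι) {f : ι → Ω → E} {a : ℝ}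
    (hf : ∀ i, L2BoundedBy μ (f i) a) :
    L2BoundedBy μ (fun ω => ∑ i ∈ s, f i ω) (s.card * a) := by
  classical
  induction s using Finset.induction_on with
  | empty => simpa using zero (μ := μ) (E := E) le_rfl
  | insert i s hi ih =>
    simp only [Finset.sum_insert hi, Finset.card_insert_of_notMem hi]
    convert (hf i).add ih using 1
    push_cast
    ring

theorem average [NormedSpace ℝ E] {M : ℕ} (hM : 0 < M) {f : Fin M → Ω → E} {a : ℝ}
    (hf : ∀ i, L2BoundedBy μ (f i) a) :
    L2BoundedBy μ (fun ω => (M : ℝ)⁻¹ • ∑ i, f i ω) a := by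
  convert (sum univ hf).smul (inv_nonneg.2 (Nat.cast_nonneg M)) using 1
  rw [card_univ, Fintype.card_fin, inv_mul_cancel_left₀ (by positivity)]

/-- Error feedback: if every residual contracts the sum of the fed-back error and an input bounded
by `b` by a factor `a < 1`, then the corrected inputs are bounded by `b / (1 - a)`. -/
theorem error_feedback {C : E → E} (hC : Measurable C) {a b : ℝ} (ha0 : 0 ≤ a) (ha1 : a < 1)
    (hCa : ∀ v, ‖v - C v‖ ≤ a * ‖v‖) {u p e : ℕ → Ω → E}
    (hb : 0 ≤ b) (hu : ∀ t, L2BoundedBy μ (u t) b) (he0 : ∀ ω, e 0 ω = 0)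
    (hp : ∀ t ω, p t ω = u t ω + e t ω) (he : ∀ t ω, e (t + 1) ω = p t ω - C (p t ω)) (t : ℕ) :
    L2BoundedBy μ (e t) (a * (b / (1 - a))) ∧ L2BoundedBy μ (p t) (b / (1 - a)) := by
  have h1a : 0 < 1 - a := sub_pos.2 ha1
  have step : ∀ s, L2BoundedBy μ (e s) (a * (b / (1 - a))) → L2BoundedBy μ (p s) (b / (1 - a)) := by
    intro s hs
    have hps : p s = fun ω => u s ω + e s ω := funext (hp s)
    rw [hps]
    convert (hu s).add hs using 1
    field_simp
    ring
  suffices h : L2BoundedBy μ (e t) (a * (b / (1 - a))) from ⟨h, step t h⟩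
  induction t with
  | zero =>
    have h0 : e 0 = fun _ => 0 := funext he0
    rw [h0]
    exact zero (by positivity)
  | succ t ih =>
    have hpt := step t ih
    have h1 : e (t + 1) = fun ω => p t ω - C (p t ω) := funext (he t)
    rw [h1]
    exact hpt.of_norm_le_mul (hpt.1.sub (hC.comp hpt.1)) ha0 fun ω => hCa _

theorem momentum [NormedSpace ℝ E] {β b : ℝ} (hβ0 : 0 ≤ β) (hβ1 : β < 1) (hb : 0 ≤ b)
    {g m : ℕ → Ω → E} (hg : ∀ t, L2BoundedBy μ (g t) b)
    (hm : ∀ t ω, m t ω = β • (if t = 0 then 0 else m (t - 1) ω) + g t ω) (t : ℕ) :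
    L2BoundedBy μ (m t) (b / (1 - β)) := by
  have hβ : 0 < 1 - β := sub_pos.2 hβ1
  have hsum : b / (1 - β) = β * (b / (1 - β)) + b := by field_simp; ring
  induction t with
  | zero =>
    have h0 : m 0 = fun ω => β • 0 + g 0 ω := funext fun ω => by simpa using hm 0 ω
    rw [h0, hsum]
    exact (smul (zero (by positivity)) hβ0).add (hg 0)
  | succ t ih =>
    have h1 : m (t + 1) = fun ω => β • m t ω + g (t + 1) ω :=
      funext fun ω => by simpa using hm (t + 1) ω
    rw [h1, hsum]
    exact (ih.smul hβ0).add (hg (t + 1))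

end L2BoundedBy

end

/-- **Server accumulated-error bound for dist-EF-SGDM** (constant stepsize).
With a `δ`-approximate compressor, momentum `μ ∈ [0,1)` and stochastic gradients with
`E[‖g_{t,i}‖²] ≤ G²`, for every `t`, `E[‖ẽ_t‖²] ≤ 64(1−δ)G²/(δ⁴(1−μ)²)`. -/
theorem dist_EF_SGDM_server_error_bound
    (d M : ℕ) (hd : 0 < d) (hM : 0 < M)
    {Ω : Type*} [MeasurableSpace Ω] (μ : Measure Ω) [IsProbabilityMeasure μ]
    (mo δ G η : ℝ) (hmo0 : 0 ≤ mo) (hmo1 : mo < 1)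
    (hδ0 : 0 < δ) (hδ1 : δ ≤ 1) (hG : 0 ≤ G) (hη : 0 < η)
    (C : EuclideanSpace ℝ (Fin d) → EuclideanSpace ℝ (Fin d))
    (hC : ∀ v, ‖C v - v‖^2 ≤ (1 - δ) * ‖v‖^2)
    (hCmeas : Measurable C)
    (g m p e : ℕ → Fin M → Ω → EuclideanSpace ℝ (Fin d))
    (pt et x : ℕ → Ω → EuclideanSpace ℝ (Fin d))
    (hgmeas : ∀ t i, Measurable (g t i))
    (hgint : ∀ t i, Integrable (fun ω => ‖g t i ω‖^2) μ)
    (hgG : ∀ t i, ∫ ω, ‖g t i ω‖^2 ∂μ ≤ G^2)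
    (he0 : ∀ i ω, e 0 i ω = 0)
    (het0 : ∀ ω, et 0 ω = 0)
    (hm : ∀ t i ω, m t i ω = mo • (if t = 0 then 0 else m (t-1) i ω) + g t i ω)
    (hp : ∀ t i ω, p t i ω = mo • m t i ω + g t i ω + e t i ω)
    (he : ∀ t i ω, e (t+1) i ω = p t i ω - C (p t i ω))
    (hpt : ∀ t ω, pt t ω = (M:ℝ)⁻¹ • ∑ i, C (p t i ω) + et t ω)
    (het : ∀ t ω, et (t+1) ω = pt t ω - C (pt t ω))
    (hx : ∀ t ω, x (t+1) ω = x t ω - η • C (pt t ω)) :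
    ∀ t, ∫ ω, ‖et t ω‖^2 ∂μ ≤ 64 * (1 - δ) * G^2 / (δ^4 * (1 - mo)^2) := by
  have hδ : 0 ≤ 1 - δ := sub_nonneg.2 hδ1
  set a := √(1 - δ) with ha
  have ha0 : 0 ≤ a := Real.sqrt_nonneg _
  have hasq : a ^ 2 = 1 - δ := Real.sq_sqrt hδ
  have ha1 : a < 1 := by nlinarith
  have h1a : 0 < 1 - a := sub_pos.2 ha1
  have hmo : 0 < 1 - mo := sub_pos.2 hmo1
  have hres : ∀ v, ‖v - C v‖ ≤ a * ‖v‖ := fun v => by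
    refine abs_le_of_sq_le_sq' ?_ (by positivity) |>.2
    rw [norm_sub_rev, mul_pow, hasq]
    exact hC v
  have hCnorm : ∀ v, ‖C v‖ ≤ (1 + a) * ‖v‖ := fun v => by
    have := norm_le_norm_add_norm_sub' (C v) v
    rw [norm_sub_rev] at this
    linarith [hres v]
  have hg : ∀ t i, L2BoundedBy μ (g t i) G := fun t i =>
    .of_integral_le (hgmeas t i) (hgint t i) hG (hgG t i)
  have hu : ∀ t i, L2BoundedBy μ (fun ω => mo • m t i ω + g t i ω) (G / (1 - mo)) := fun t i => by
    have hmt := L2BoundedBy.momentum hmo0 hmo1 hG (fun t => hg t i) (fun t ω => hm t i ω) t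
    convert (hmt.smul hmo0).add (hg t i) using 1
    field_simp
    ring
  have hpb : ∀ t i, L2BoundedBy μ (p t i) (G / (1 - mo) / (1 - a)) := fun t i =>
    (L2BoundedBy.error_feedback (p := fun t => p t i) (e := fun t => e t i) hCmeas ha0 ha1 hres
      (by positivity) (fun t => hu t i) (he0 i) (fun t => hp t i) (fun t => he t i) t).2
  have hCp : ∀ t, L2BoundedBy μ (fun ω => (M : ℝ)⁻¹ • ∑ i, C (p t i ω))
      ((1 + a) * (G / (1 - mo) / (1 - a))) := fun t =>
    .average hM fun i => (hpb t i).of_norm_le_mul (hCmeas.comp (hpb t i).1) (by positivity)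
      fun ω => hCnorm _
  intro t
  refine (L2BoundedBy.error_feedback hCmeas ha0 ha1 hres (by positivity) hCp het0 hpt het
    t).1.integral_le.trans ?_
  have hδa : δ = (1 - a) * (1 + a) := by linear_combination hasq
  calc (a * ((1 + a) * (G / (1 - mo) / (1 - a)) / (1 - a))) ^ 2
      = (1 + a) ^ 6 * ((1 - δ) * G ^ 2 / (δ ^ 4 * (1 - mo) ^ 2)) := by
        rw [← hasq, hδa]
        field_simp
    _ ≤ 2 ^ 6 * ((1 - δ) * G ^ 2 / (δ ^ 4 * (1 - mo) ^ 2)) := by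
        gcongr
        linarith
    _ = 64 * (1 - δ) * G ^ 2 / (δ ^ 4 * (1 - mo) ^ 2) := by ring
end

section
/- Consider dist-EF-SGDM with momentum parameter µ ∈ [0,1), constant stepsize η_t = η > 0, a δ-approximate compressor 𝒞 (δ ∈ (0,1]), and stochastic gradients g_{t,i} satisfying E[‖g_{t,i}‖_2²] ≤ G² for all t, i. Then for every t ≥ 0, the total accumulated error satisfies E[‖ẽ_t + (1/M) Σ_{i=1}^M e_{t,i}‖_2²] ≤ (8(1−δ)G² / (δ²(1−µ)²)) · (1 + 16/δ²). -/
open Finset MeasureTheory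

section L2Bound

variable {Ω : Type*} [MeasurableSpace Ω] {μ : Measure Ω}
  {V : Type*} [NormedAddCommGroup V]

/-- `f` is square integrable with `L²` norm at most `c`. -/
def L2Bound (μ : Measure Ω) (f : Ω → V) (c : ℝ) : Prop :=
  MemLp f 2 μ ∧ eLpNorm f 2 μ ≤ ENNReal.ofReal c

namespace L2Bound

theorem eLpNorm_le_iff_integral_sq_le {f : Ω → V} (hf : MemLp f 2 μ) {c : ℝ} (hc : 0 ≤ c) :
    eLpNorm f 2 μ ≤ ENNReal.ofReal c ↔ ∫ ω, ‖f ω‖ ^ 2 ∂μ ≤ c ^ 2 := by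
  have hI : 0 ≤ ∫ ω, ‖f ω‖ ^ 2 ∂μ := integral_nonneg fun ω => by positivity
  rw [hf.eLpNorm_eq_integral_rpow_norm two_ne_zero ENNReal.ofNat_ne_top,
    ENNReal.ofReal_le_ofReal_iff hc]
  simp only [ENNReal.toReal_ofNat, Real.rpow_two]
  rw [← one_div, ← Real.sqrt_eq_rpow, Real.sqrt_le_left hc]

theorem integral_sq_le {f : Ω → V} {c : ℝ} (hf : L2Bound μ f c) (hc : 0 ≤ c) :
    ∫ ω, ‖f ω‖ ^ 2 ∂μ ≤ c ^ 2 :=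
  (eLpNorm_le_iff_integral_sq_le hf.1 hc).1 hf.2

theorem mono {f : Ω → V} {a b : ℝ} (hf : L2Bound μ f a) (hab : a ≤ b) : L2Bound μ f b :=
  ⟨hf.1, hf.2.trans (ENNReal.ofReal_le_ofReal hab)⟩

theorem zero : L2Bound μ (fun _ => (0 : V)) 0 :=
  ⟨MemLp.zero', by simp⟩

theorem add {f g : Ω → V} {a b : ℝ} (hf : L2Bound μ f a) (hg : L2Bound μ g b)
    (ha : 0 ≤ a) (hb : 0 ≤ b) : L2Bound μ (fun ω => f ω + g ω) (a + b) := by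
  refine ⟨hf.1.add hg.1, ?_⟩
  rw [ENNReal.ofReal_add ha hb]
  exact (eLpNorm_add_le hf.1.1 hg.1.1 one_le_two).trans (add_le_add hf.2 hg.2)

theorem of_norm_le_mul {W : Type*} [NormedAddCommGroup W] {f : Ω → V} {h : Ω → W} {a k : ℝ}
    (hf : L2Bound μ f a) (hk : 0 ≤ k) (hh : AEStronglyMeasurable h μ)
    (hle : ∀ ω, ‖h ω‖ ≤ k * ‖f ω‖) : L2Bound μ h (k * a) := by
  refine ⟨hf.1.of_le_mul hh (.of_forall hle), ?_⟩
  rw [ENNReal.ofReal_mul hk]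
  exact (eLpNorm_le_mul_eLpNorm_of_ae_le_mul (.of_forall hle) 2).trans (by gcongr; exact hf.2)

theorem smul [NormedSpace ℝ V] {f : Ω → V} {a k : ℝ} (hf : L2Bound μ f a) (hk : 0 ≤ k) :
    L2Bound μ (fun ω => k • f ω) (k * a) :=
  hf.of_norm_le_mul hk (hf.1.1.const_smul k) fun ω => by
    rw [norm_smul, Real.norm_of_nonneg hk]

theorem sum {ι : Type*} {f : ι → Ω → V} {a : ℝ} (hf : ∀ i, L2Bound μ (f i) a)
    (ha : 0 ≤ a) (s : Finset ι) : L2Bound μ (fun ω => ∑ i ∈ s, f i ω) (#s * a) := by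
  classical
  induction s using Finset.induction_on with
  | empty => simpa using zero
  | insert i s hi ih =>
    simp only [Finset.sum_insert hi, Finset.card_insert_of_notMem hi]
    exact ((hf i).add ih ha (by positivity)).mono (by push_cast; linarith)

theorem average [NormedSpace ℝ V] {M : ℕ} (hM : 0 < M) {f : Fin M → Ω → V} {a : ℝ}
    (hf : ∀ i, L2Bound μ (f i) a) (ha : 0 ≤ a) :
    L2Bound μ (fun ω => (M : ℝ)⁻¹ • ∑ i, f i ω) a := by
  have hM' : (0 : ℝ) < M := by exact_mod_cast hM
  refine ((sum hf ha univ).smul (inv_nonneg.2 hM'.le)).mono (le_of_eq ?_)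
  rw [card_univ, Fintype.card_fin, inv_mul_cancel_left₀ hM'.ne']

end L2Bound

end L2Bound

theorem delta_add_two_mul_sqrt_le {δ : ℝ} (hδ : δ ≤ 1) : δ + 2 * √(1 - δ) ≤ 2 := by
  nlinarith [sq_nonneg (√(1 - δ) - 1), Real.sq_sqrt (sub_nonneg.2 hδ)]

/-- `2√(1-δ)a/δ` is a supersolution of the error recursion `e ↦ √(1-δ)(a + e)`. -/
theorem error_recursion_le {δ a : ℝ} (hδ0 : 0 < δ) (hδ1 : δ ≤ 1) (ha : 0 ≤ a) :
    √(1 - δ) * (a + 2 * √(1 - δ) * a / δ) ≤ 2 * √(1 - δ) * a / δ := by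
  have h := mul_le_mul_of_nonneg_left (delta_add_two_mul_sqrt_le hδ1)
    (mul_nonneg (Real.sqrt_nonneg (1 - δ)) ha)
  rw [le_div_iff₀ hδ0]
  field_simp
  linarith

theorem norm_compressor_residual_le {V : Type*} [NormedAddCommGroup V] {C : V → V} {δ : ℝ}
    (hδ : δ ≤ 1) (hC : ∀ v, ‖C v - v‖ ^ 2 ≤ (1 - δ) * ‖v‖ ^ 2) (v : V) :
    ‖v - C v‖ ≤ √(1 - δ) * ‖v‖ := by
  rw [norm_sub_rev]
  refine le_of_sq_le_sq ?_ (by positivity)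
  rw [mul_pow, Real.sq_sqrt (sub_nonneg.2 hδ)]
  exact hC v

open Finset MeasureTheory

/-- **Total accumulated-error bound for dist-EF-SGDM** (constant stepsize).
With a `δ`-approximate compressor, momentum `μ ∈ [0,1)` and stochastic gradients with
`E[‖g_{t,i}‖²] ≤ G²`, for every `t`,
`E[‖ẽ_t + (1/M)∑ᵢ e_{t,i}‖²] ≤ (8(1−δ)G²/(δ²(1−μ)²))·(1 + 16/δ²)`. -/
theorem dist_EF_SGDM_total_error_bound
    (d M : ℕ) (hd : 0 < d) (hM : 0 < M)
    {Ω : Type*} [MeasurableSpace Ω] (μ : Measure Ω) [IsProbabilityMeasure μ]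
    (mo δ G η : ℝ) (hmo0 : 0 ≤ mo) (hmo1 : mo < 1)
    (hδ0 : 0 < δ) (hδ1 : δ ≤ 1) (hG : 0 ≤ G) (hη : 0 < η)
    (C : EuclideanSpace ℝ (Fin d) → EuclideanSpace ℝ (Fin d))
    (hC : ∀ v, ‖C v - v‖^2 ≤ (1 - δ) * ‖v‖^2)
    (hCmeas : Measurable C)
    (g m p e : ℕ → Fin M → Ω → EuclideanSpace ℝ (Fin d))
    (pt et x : ℕ → Ω → EuclideanSpace ℝ (Fin d))
    (hgmeas : ∀ t i, Measurable (g t i))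
    (hgint : ∀ t i, Integrable (fun ω => ‖g t i ω‖^2) μ)
    (hgG : ∀ t i, ∫ ω, ‖g t i ω‖^2 ∂μ ≤ G^2)
    (he0 : ∀ i ω, e 0 i ω = 0)
    (het0 : ∀ ω, et 0 ω = 0)
    (hm : ∀ t i ω, m t i ω = mo • (if t = 0 then 0 else m (t-1) i ω) + g t i ω)
    (hp : ∀ t i ω, p t i ω = mo • m t i ω + g t i ω + e t i ω)
    (he : ∀ t i ω, e (t+1) i ω = p t i ω - C (p t i ω))
    (hpt : ∀ t ω, pt t ω = (M:ℝ)⁻¹ • ∑ i, C (p t i ω) + et t ω)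
    (het : ∀ t ω, et (t+1) ω = pt t ω - C (pt t ω))
    (hx : ∀ t ω, x (t+1) ω = x t ω - η • C (pt t ω)) :
    ∀ t, ∫ ω, ‖et t ω + (M:ℝ)⁻¹ • ∑ i, e t i ω‖^2 ∂μ
      ≤ (8 * (1 - δ) * G^2 / (δ^2 * (1 - mo)^2)) * (1 + 16/δ^2) := by
  set A := G / (1 - mo) with hA
  set s := √(1 - δ) with hs
  have hmo : 0 < 1 - mo := sub_pos.2 hmo1
  have hA0 : 0 ≤ A := by positivity
  have hs0 : 0 ≤ s := Real.sqrt_nonneg _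
  have hs1 : s ≤ 1 := Real.sqrt_le_one.2 (by linarith)
  have hsq : s ^ 2 = 1 - δ := Real.sq_sqrt (by linarith)
  have hAeq : mo * A + G = A := by rw [hA]; field_simp; ring
  have hres : ∀ v, ‖v - C v‖ ≤ s * ‖v‖ := norm_compressor_residual_le hδ1 hC
  have hCn : ∀ v, ‖C v‖ ≤ (1 + s) * ‖v‖ := fun v => by
    have := norm_sub_le v (v - C v)
    rw [sub_sub_cancel] at this
    linarith [hres v]
  have hCm : ∀ {f : Ω → EuclideanSpace ℝ (Fin d)}, MemLp f 2 μ →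
      AEStronglyMeasurable (fun ω => C (f ω)) μ := fun hf =>
    (hCmeas.comp_aemeasurable hf.1.aemeasurable).aestronglyMeasurable
  have hg : ∀ t i, L2Bound μ (g t i) G := fun t i => by
    have hLp : MemLp (g t i) 2 μ :=
      (memLp_two_iff_integrable_sq_norm (hgmeas t i).aestronglyMeasurable).2 (hgint t i)
    exact ⟨hLp, (L2Bound.eLpNorm_le_iff_integral_sq_le hLp hG).2 (hgG t i)⟩
  have hmB : ∀ t i, L2Bound μ (m t i) A := fun t i => by
    induction t with
    | zero =>
      have : m 0 i = g 0 i := by funext ω; simp [hm 0 i ω]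
      rw [this]
      exact (hg 0 i).mono (by nlinarith)
    | succ t ih =>
      have : m (t + 1) i = fun ω => mo • m t i ω + g (t + 1) i ω := by
        funext ω; simp [hm (t + 1) i ω]
      rw [this, ← hAeq]
      exact (ih.smul hmo0).add (hg _ i) (by positivity) hG
  set E := 2 * s * A / δ with hE
  have hE0 : 0 ≤ E := by positivity
  have hpB : ∀ t i, L2Bound μ (e t i) E → L2Bound μ (p t i) (A + E) := fun t i h => by
    have : p t i = fun ω => mo • m t i ω + g t i ω + e t i ω := funext (hp t i)
    rw [this]
    refine ((((hmB t i).smul hmo0).add (hg t i) (by positivity) hG).add h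
      (by positivity) hE0).mono ?_
    rw [hAeq]
  have heB : ∀ t i, L2Bound μ (e t i) E := fun t i => by
    induction t with
    | zero =>
      have : e 0 i = fun _ => 0 := funext (he0 i)
      rw [this]
      exact L2Bound.zero.mono hE0
    | succ t ih =>
      have : e (t + 1) i = fun ω => p t i ω - C (p t i ω) := funext (he t i)
      have hpt := hpB t i ih
      rw [this]
      exact (hpt.of_norm_le_mul hs0 (hpt.1.1.sub (hCm hpt.1)) fun ω => hres _).mono
        (error_recursion_le hδ0 hδ1 hA0)
  set B := 4 * A / δ with hB
  have hB0 : 0 ≤ B := by positivity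
  have hCp : ∀ t i, L2Bound μ (fun ω => C (p t i ω)) B := fun t i => by
    have hpt := hpB t i (heB t i)
    refine (hpt.of_norm_le_mul (by positivity) (hCm hpt.1) fun ω => hCn _).mono ?_
    have h2 : δ + 2 * s ≤ 2 := delta_add_two_mul_sqrt_le hδ1
    have h4 : (1 + s) * (δ + 2 * s) ≤ 2 * 2 := by gcongr; linarith
    have h5 := mul_le_mul_of_nonneg_right h4 hA0
    rw [hE, hB, le_div_iff₀ hδ0]
    field_simp
    linarith
  set F := 2 * s * B / δ with hF
  have hF0 : 0 ≤ F := by positivity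
  have hetB : ∀ t, L2Bound μ (et t) F := fun t => by
    induction t with
    | zero =>
      have : et 0 = fun _ => 0 := funext het0
      rw [this]
      exact L2Bound.zero.mono hF0
    | succ t ih =>
      have hptB : L2Bound μ (pt t) (B + F) := by
        have : pt t = fun ω => (M : ℝ)⁻¹ • ∑ i, C (p t i ω) + et t ω := funext (hpt t)
        rw [this]
        exact (L2Bound.average hM (hCp t) hB0).add ih hB0 hF0
      have : et (t + 1) = fun ω => pt t ω - C (pt t ω) := funext (het t)
      rw [this]
      exact (hptB.of_norm_le_mul hs0 (hptB.1.1.sub (hCm hptB.1)) fun ω => hres _).mono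
        (error_recursion_le hδ0 hδ1 hB0)
  intro t
  calc ∫ ω, ‖et t ω + (M : ℝ)⁻¹ • ∑ i, e t i ω‖ ^ 2 ∂μ
      ≤ (F + E) ^ 2 :=
        ((hetB t).add (L2Bound.average hM (heB t) hE0) hF0 hE0).integral_sq_le (by positivity)
    _ ≤ 2 * (F ^ 2 + E ^ 2) := add_sq_le
    _ = (8 * (1 - δ) * G ^ 2 / (δ ^ 2 * (1 - mo) ^ 2)) * (1 + 16 / δ ^ 2) := by
        rw [← hsq, hF, hE, hB, hA]
        field_simp
        ring
end

section
/- Consider dist-EF-SGD (i.e., dist-EF-SGDM with µ = 0) with constant stepsize η_t = η > 0, a δ-approximate compressor 𝒞 (δ ∈ (0,1]), and stochastic gradients g_{t,i} satisfying E[‖g_{t,i}‖_2²] ≤ G² for all t, i. Then for every t ≥ 0, E[‖ẽ_t + (1/M) Σ_{i=1}^M e_{t,i}‖_2²] ≤ (8(1−δ)G² / δ²) · (1 + 16/δ²). -/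
open Finset MeasureTheory

section ErrorFeedback

variable {Ω E : Type*} [MeasurableSpace Ω] {μ : Measure Ω} [NormedAddCommGroup E]
  [MeasurableSpace E]

/-- `f` is measurable and its `L²` norm is at most `c`. -/
def MeasurableL2Bound (μ : Measure Ω) (f : Ω → E) (c : ℝ) : Prop :=
  Measurable f ∧ eLpNorm f 2 μ ≤ ENNReal.ofReal c

namespace MeasurableL2Bound

variable {f h : Ω → E} {a b c : ℝ}

theorem zero (c : ℝ) : MeasurableL2Bound μ (fun _ => (0 : E)) c :=
  ⟨measurable_const, by simp⟩

theorem of_norm_le_mul (hf : MeasurableL2Bound μ f a) (hh : Measurable h) (hc : 0 ≤ c)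
    (hle : ∀ ω, ‖h ω‖ ≤ c * ‖f ω‖) : MeasurableL2Bound μ h (c * a) := by
  refine ⟨hh, ?_⟩
  rw [ENNReal.ofReal_mul hc]
  exact (eLpNorm_le_mul_eLpNorm_of_ae_le_mul (Filter.Eventually.of_forall hle) 2).trans
    (mul_le_mul_right hf.2 _)

variable [BorelSpace E] [SecondCountableTopology E]

theorem add (hf : MeasurableL2Bound μ f a) (hh : MeasurableL2Bound μ h b) (ha : 0 ≤ a)
    (hb : 0 ≤ b) : MeasurableL2Bound μ (fun ω => f ω + h ω) (a + b) := by
  refine ⟨hf.1.add hh.1, ?_⟩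
  rw [ENNReal.ofReal_add ha hb]
  exact (eLpNorm_add_le hf.1.aestronglyMeasurable hh.1.aestronglyMeasurable (by norm_num)).trans
    (add_le_add hf.2 hh.2)

theorem sum {ι : Type*} (s : Finset ι) {F : ι → Ω → E} (hF : ∀ i, MeasurableL2Bound μ (F i) c)
    (hc : 0 ≤ c) : MeasurableL2Bound μ (fun ω => ∑ i ∈ s, F i ω) (#s * c) := by
  classical
  induction s using Finset.induction_on with
  | empty => simpa using zero (μ := μ) (E := E) 0
  | insert i s hi ih =>
    have := (hF i).add ih hc (by positivity)
    simp only [sum_insert hi, card_insert_of_notMem hi, Nat.cast_succ]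
    convert this using 1
    ring

theorem average [NormedSpace ℝ E] {M : ℕ} (hM : 0 < M) {F : Fin M → Ω → E}
    (hF : ∀ i, MeasurableL2Bound μ (F i) c) (hc : 0 ≤ c) :
    MeasurableL2Bound μ (fun ω => (M : ℝ)⁻¹ • ∑ i, F i ω) c := by
  have hs := sum univ hF hc
  have := hs.of_norm_le_mul (h := fun ω => (M : ℝ)⁻¹ • ∑ i, F i ω) (c := (M : ℝ)⁻¹)
    (hs.1.const_smul _) (by positivity) fun ω => by simp [norm_smul]
  have hM' : (M : ℝ) ≠ 0 := by positivity
  convert this using 1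
  simp only [card_univ, Fintype.card_fin]
  field_simp

theorem integral_norm_sq_le (hf : MeasurableL2Bound μ f c) (hc : 0 ≤ c) :
    ∫ ω, ‖f ω‖ ^ 2 ∂μ ≤ c ^ 2 := by
  have hmem : MemLp f 2 μ := ⟨hf.1.aestronglyMeasurable, hf.2.trans_lt ENNReal.ofReal_lt_top⟩
  have h := hf.2
  rw [hmem.eLpNorm_eq_integral_rpow_norm (by norm_num) (by norm_num),
    ENNReal.ofReal_le_ofReal_iff hc] at h
  simp only [ENNReal.toReal_ofNat, Real.rpow_two] at h
  rw [← one_div, ← Real.sqrt_eq_rpow] at h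
  exact (Real.sqrt_le_left hc).1 h

theorem of_integral_norm_sq_le (hf : Measurable f) (hint : Integrable (fun ω => ‖f ω‖ ^ 2) μ)
    (hc : 0 ≤ c) (hle : ∫ ω, ‖f ω‖ ^ 2 ∂μ ≤ c ^ 2) : MeasurableL2Bound μ f c := by
  have hmem : MemLp f 2 μ := (memLp_two_iff_integrable_sq_norm hf.aestronglyMeasurable).2 hint
  refine ⟨hf, ?_⟩
  rw [hmem.eLpNorm_eq_integral_rpow_norm (by norm_num) (by norm_num),
    ENNReal.ofReal_le_ofReal_iff hc]
  simp only [ENNReal.toReal_ofNat, Real.rpow_two]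
  rw [← one_div, ← Real.sqrt_eq_rpow]
  exact (Real.sqrt_le_left hc).2 hle

/-- An error-feedback recursion driven by inputs of `L²` norm at most `K`, whose compressor has
relative error at most `r < 1`, keeps its error below `r K / (1 - r)` in `L²`. -/
theorem error_feedback {C : E → E} {r K : ℝ} (hr0 : 0 ≤ r) (hr1 : r < 1) (hK : 0 ≤ K)
    (hC : ∀ v, ‖v - C v‖ ≤ r * ‖v‖) (hCmeas : Measurable C) {u q err : ℕ → Ω → E}
    (hu : ∀ t, MeasurableL2Bound μ (u t) K) (herr0 : ∀ ω, err 0 ω = 0)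
    (hq : ∀ t ω, q t ω = u t ω + err t ω)
    (herr : ∀ t ω, err (t + 1) ω = q t ω - C (q t ω)) (t : ℕ) :
    MeasurableL2Bound μ (err t) (r * K / (1 - r)) ∧ MeasurableL2Bound μ (q t) (K / (1 - r)) := by
  have h1 : 0 < 1 - r := sub_pos.2 hr1
  have key : ∀ t, MeasurableL2Bound μ (err t) (r * K / (1 - r)) →
      MeasurableL2Bound μ (q t) (K / (1 - r)) := fun t ht => by
    rw [funext (hq t)]
    convert (hu t).add ht hK (by positivity) using 1
    field_simp
    ring
  suffices h : MeasurableL2Bound μ (err t) (r * K / (1 - r)) from ⟨h, key t h⟩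
  induction t with
  | zero =>
    rw [funext herr0]
    exact zero _
  | succ t ih =>
    have hqt := key t ih
    rw [funext (herr t), mul_div_assoc]
    exact hqt.of_norm_le_mul (hqt.1.sub (hCmeas.comp hqt.1)) hr0 fun ω => hC _

end MeasurableL2Bound

end ErrorFeedback

/-- **Total accumulated-error bound for dist-EF-SGD** (constant stepsize, `μ = 0`).
With a `δ`-approximate compressor and stochastic gradients with `E[‖g_{t,i}‖²] ≤ G²`,
for every `t`, `E[‖ẽ_t + (1/M)∑ᵢ e_{t,i}‖²] ≤ (8(1−δ)G²/δ²)·(1 + 16/δ²)`. -/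
theorem dist_EF_SGD_total_error_bound
    (d M : ℕ) (hd : 0 < d) (hM : 0 < M)
    {Ω : Type*} [MeasurableSpace Ω] (μ : Measure Ω) [IsProbabilityMeasure μ]
    (δ G η : ℝ) (hδ0 : 0 < δ) (hδ1 : δ ≤ 1) (hG : 0 ≤ G) (hη : 0 < η)
    (C : EuclideanSpace ℝ (Fin d) → EuclideanSpace ℝ (Fin d))
    (hC : ∀ v, ‖C v - v‖^2 ≤ (1 - δ) * ‖v‖^2)
    (hCmeas : Measurable C)
    (g p e : ℕ → Fin M → Ω → EuclideanSpace ℝ (Fin d))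
    (pt et x : ℕ → Ω → EuclideanSpace ℝ (Fin d))
    (hgmeas : ∀ t i, Measurable (g t i))
    (hgint : ∀ t i, Integrable (fun ω => ‖g t i ω‖^2) μ)
    (hgG : ∀ t i, ∫ ω, ‖g t i ω‖^2 ∂μ ≤ G^2)
    (he0 : ∀ i ω, e 0 i ω = 0)
    (het0 : ∀ ω, et 0 ω = 0)
    (hp : ∀ t i ω, p t i ω = g t i ω + e t i ω)
    (he : ∀ t i ω, e (t+1) i ω = p t i ω - C (p t i ω))
    (hpt : ∀ t ω, pt t ω = (M:ℝ)⁻¹ • ∑ i, C (p t i ω) + et t ω)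
    (het : ∀ t ω, et (t+1) ω = pt t ω - C (pt t ω))
    (hx : ∀ t ω, x (t+1) ω = x t ω - η • C (pt t ω)) :
    ∀ t, ∫ ω, ‖et t ω + (M:ℝ)⁻¹ • ∑ i, e t i ω‖^2 ∂μ
      ≤ (8 * (1 - δ) * G^2 / δ^2) * (1 + 16/δ^2) := by
  obtain ⟨r, hr⟩ : ∃ r, r = √(1 - δ) := ⟨_, rfl⟩
  have hr0 : 0 ≤ r := hr ▸ Real.sqrt_nonneg _
  have hrsq : r ^ 2 = 1 - δ := by rw [hr, Real.sq_sqrt (by linarith)]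
  have hr1 : r < 1 := by nlinarith
  have h1 : 0 < 1 - r := sub_pos.2 hr1
  have hCr : ∀ v, ‖v - C v‖ ≤ r * ‖v‖ := fun v => by
    refine le_of_sq_le_sq ?_ (by positivity)
    rw [norm_sub_rev, mul_pow, hrsq]
    exact hC v
  have hworker := fun i => MeasurableL2Bound.error_feedback hr0 hr1 hG hCr hCmeas
    (fun t => .of_integral_norm_sq_le (hgmeas t i) (hgint t i) hG (hgG t i))
    (he0 i) (fun t => hp t i) (fun t => he t i)
  have hK : 0 ≤ (1 + r) * (G / (1 - r)) := by positivity
  have hΔ : ∀ t i, MeasurableL2Bound μ (fun ω => C (p t i ω)) ((1 + r) * (G / (1 - r))) :=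
    fun t i => (hworker i t).2.of_norm_le_mul (hCmeas.comp (hworker i t).2.1) (by positivity)
      fun ω => by
        have h := norm_sub_norm_le (C (p t i ω)) (p t i ω)
        rw [norm_sub_rev] at h
        linarith [hCr (p t i ω)]
  have hserver := MeasurableL2Bound.error_feedback hr0 hr1 hK hCr hCmeas
    (fun t => .average hM (hΔ t) hK) het0 hpt het
  intro t
  have hA : 0 ≤ r * G / (1 - r) := by positivity
  have hB : 0 ≤ r * ((1 + r) * (G / (1 - r))) / (1 - r) := by positivity
  have hAle : r * G / (1 - r) ≤ 2 * r * G / δ := by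
    rw [div_le_div_iff₀ h1 hδ0, show δ = (1 - r) * (1 + r) by linarith]
    have : 0 ≤ r * G * (1 - r) * (1 - r) := by positivity
    linarith
  have hBle : r * ((1 + r) * (G / (1 - r))) / (1 - r) ≤ 8 * r * G / δ ^ 2 := by
    have hcube : (1 + r) ^ 3 ≤ 2 ^ 3 := pow_le_pow_left₀ (by positivity) (by linarith) 3
    calc r * ((1 + r) * (G / (1 - r))) / (1 - r) = r * G * (1 + r) ^ 3 / δ ^ 2 := by
          rw [show δ = (1 - r) * (1 + r) by linarith]
          field_simp
      _ ≤ r * G * 2 ^ 3 / δ ^ 2 := by gcongr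
      _ = 8 * r * G / δ ^ 2 := by ring
  refine (((hserver t).1.add (.average hM (fun i => (hworker i t).1) hA) hB hA).integral_norm_sq_le
    (add_nonneg hB hA)).trans ?_
  calc _ ≤ (8 * r * G / δ ^ 2 + 2 * r * G / δ) ^ 2 := by gcongr
    _ ≤ 2 * ((8 * r * G / δ ^ 2) ^ 2 + (2 * r * G / δ) ^ 2) := add_sq_le
    _ = (8 * r ^ 2 * G ^ 2 / δ ^ 2) * (1 + 16 / δ ^ 2) := by
      field_simp
      ring
    _ = _ := by rw [hrsq]
end

section
/- Consider dist-EF-SGDM with momentum parameter µ ∈ [0,1), constant stepsize η > 0, any map 𝒞 : ℝ^d → ℝ^d, and arbitrary vectors g_{t,i} ∈ ℝ^d. Let x̃_t = x_t − η(ẽ_t + (1/M) Σ_{i=1}^M e_{t,i}) be the error-corrected iterate and define the virtual iterate z_t = x̃_t − (ηµ²/(1−µ)) (1/M) Σ_{i=1}^M m_{t−1,i}. Then for every t ≥ 0, z_{t+1} = z_t − (η/(1−µ)) (1/M) Σ_{i=1}^M g_{t,i}. -/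
open Finset

/-- **Virtual iterate recurrence for dist-EF-SGDM.**
With constant stepsize `η`, momentum `μ ∈ [0,1)`, error-corrected iterate
`x̃ₜ = xₜ − η(ẽₜ + (1/M)∑ᵢ e_{t,i})` and virtual iterate
`zₜ = x̃ₜ − (ημ²/(1−μ)) (1/M)∑ᵢ m_{t−1,i}`, one has
`z_{t+1} = zₜ − (η/(1−μ)) (1/M)∑ᵢ g_{t,i}`.  The convention `m_{−1,i} = 0` is encoded
via `if t = 0 then 0 else …`. -/
theorem dist_EF_SGDM_virtual_iterate_recurrence
    (d M : ℕ) (hd : 0 < d) (hM : 0 < M)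
    (μ : ℝ) (hμ0 : 0 ≤ μ) (hμ1 : μ < 1)
    (η : ℝ) (hη : 0 < η)
    (C : EuclideanSpace ℝ (Fin d) → EuclideanSpace ℝ (Fin d))
    (g m p e : ℕ → Fin M → EuclideanSpace ℝ (Fin d))
    (pt et x : ℕ → EuclideanSpace ℝ (Fin d))
    (he0 : ∀ i, e 0 i = 0)
    (het0 : et 0 = 0)
    (hm : ∀ t i, m t i = μ • (if t = 0 then 0 else m (t-1) i) + g t i)
    (hp : ∀ t i, p t i = μ • m t i + g t i + e t i)
    (he : ∀ t i, e (t+1) i = p t i - C (p t i))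
    (hpt : ∀ t, pt t = (M:ℝ)⁻¹ • ∑ i, C (p t i) + et t)
    (het : ∀ t, et (t+1) = pt t - C (pt t))
    (hx : ∀ t, x (t+1) = x t - η • C (pt t)) :
    ∀ t,
      ((x (t+1) - η • (et (t+1) + (M:ℝ)⁻¹ • ∑ i, e (t+1) i))
          - (η * μ^2 / (1 - μ)) • ((M:ℝ)⁻¹ • ∑ i, m t i))
        = ((x t - η • (et t + (M:ℝ)⁻¹ • ∑ i, e t i))
            - (η * μ^2 / (1 - μ)) • ((M:ℝ)⁻¹ • ∑ i, (if t = 0 then 0 else m (t-1) i)))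
          - (η / (1 - μ)) • ((M:ℝ)⁻¹ • ∑ i, g t i) := by
  intro t
  have hμ : 1 - μ ≠ 0 := by linarith
  have hsum_m : ∑ i, m t i = μ • ∑ i, (if t = 0 then 0 else m (t-1) i) + ∑ i, g t i := by
    rw [Finset.smul_sum, ← Finset.sum_add_distrib]
    exact Finset.sum_congr rfl fun i _ => hm t i
  have hsum_e : ∑ i, e (t+1) i
      = μ • ∑ i, m t i + ∑ i, g t i + ∑ i, e t i - ∑ i, C (p t i) := by
    rw [Finset.smul_sum, ← Finset.sum_add_distrib, ← Finset.sum_add_distrib,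
      ← Finset.sum_sub_distrib]
    exact Finset.sum_congr rfl fun i _ => by rw [he, ← hp]
  have het_succ : et (t+1) = (M:ℝ)⁻¹ • ∑ i, C (p t i) + et t - C (pt t) := by
    rw [het, ← hpt]
  rw [hx, het_succ, hsum_e, hsum_m]
  match_scalars <;> field_simp <;> ring
end
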